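/- For every integer n ≥ 2120, (√12·π²·e^{μ(n)}/(36·μ(n)^{14}))·(μ(n)^{12} − μ(n)^{11} − 1) < p(n) < (√12·π²·e^{μ(n)}/(36·μ(n)^{14}))·(μ(n)^{12} − μ(n)^{11} + 1). -/

import Mathlib

/-- The partition function: the number of partitions of `n`. -/
def partitionFn (n : ℕ) : ℕ := Fintype.card (Nat.Partition n)

/-- `μ(n) = π √(24 n - 1) / 6`. -/
noncomputable def muP (n : ℕ) : ℝ := Real.pi * Real.sqrt (24 * (n : ℝ) - 1) / 6

open Complex Set Filter Topology MeasureTheory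
open Real (pi_pos)
open scoped Real

open PowerSeries PowerSeries.WithPiTopology in
theorem mk_partitionFn_mul_pentagonalSeries :
    (PowerSeries.mk fun n ↦ (partitionFn n : ℂ)) * pentagonalSeries ℂ = 1 := by
  classical
  let _ : TopologicalSpace ℂ := ⊥
  have _ : DiscreteTopology ℂ := ⟨rfl⟩
  have h1 := Nat.Partition.hasProd_powerSeriesMk_card_restricted ℂ (fun _ ↦ True)
  have h2 := PowerSeries.WithPiTopology.hasProd_one_sub_X_pow ℂ
  have h3 := h1.mul h2
  have h4 : (fun i : ℕ ↦ (if True then ∑' j : ℕ, (PowerSeries.X : ℂ⟦X⟧) ^ ((i + 1) * j) else 1) *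
      (1 - PowerSeries.X ^ (i + 1))) = fun _ ↦ 1 := by
    funext i
    simp only [if_true, pow_mul]
    exact PowerSeries.WithPiTopology.tsum_pow_mul_one_sub_of_constantCoeff_eq_zero (by simp)
  rw [h4] at h3
  have h5 := h3.unique hasProd_one
  rw [← h5]
  congr 2
  funext n
  simp [partitionFn, Nat.Partition.restricted, Finset.card_univ]

/-- The Taylor series at `0` of a complex function, as a formal power series. -/
noncomputable def taylorPowerSeries (f : ℂ → ℂ) : PowerSeries ℂ :=
  PowerSeries.mk fun n ↦ (n.factorial : ℂ)⁻¹ * iteratedDeriv n f 0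

theorem taylorPowerSeries_mul {f g : ℂ → ℂ} (hf : AnalyticAt ℂ f 0) (hg : AnalyticAt ℂ g 0) :
    taylorPowerSeries (f * g) = taylorPowerSeries f * taylorPowerSeries g := by
  ext n
  simp only [taylorPowerSeries, PowerSeries.coeff_mk, PowerSeries.coeff_mul]
  rw [iteratedDeriv_mul hf.contDiffAt hg.contDiffAt, Finset.mul_sum,
    Finset.Nat.sum_antidiagonal_eq_sum_range_succ_mk]
  refine Finset.sum_congr rfl fun i hi ↦ ?_
  have hi' : i ≤ n := Nat.lt_succ_iff.mp (Finset.mem_range.mp hi)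
  rw [Nat.cast_choose ℂ hi']
  have h0 : (n.factorial : ℂ) ≠ 0 := mod_cast n.factorial_ne_zero
  have h1 : (i.factorial : ℂ) ≠ 0 := mod_cast i.factorial_ne_zero
  have h2 : ((n - i).factorial : ℂ) ≠ 0 := mod_cast (n - i).factorial_ne_zero
  field_simp

theorem taylorPowerSeries_congr {f g : ℂ → ℂ} (h : f =ᶠ[nhds 0] g) :
    taylorPowerSeries f = taylorPowerSeries g := by
  ext n
  simp [taylorPowerSeries, h.iteratedDeriv_eq n]

theorem taylorPowerSeries_one : taylorPowerSeries 1 = 1 := by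
  ext n
  have : (1 : ℂ → ℂ) = fun _ ↦ 1 := rfl
  rw [taylorPowerSeries, PowerSeries.coeff_mk, PowerSeries.coeff_one, this, iteratedDeriv_const]
  split_ifs with h <;> simp [h]

theorem taylorPowerSeries_one_sub_pow (k : ℕ) :
    taylorPowerSeries (fun q ↦ 1 - q ^ (k + 1)) = 1 - PowerSeries.X ^ (k + 1) := by
  ext n
  rw [taylorPowerSeries, PowerSeries.coeff_mk, map_sub, PowerSeries.coeff_one,
    PowerSeries.coeff_X_pow, iteratedDeriv_fun_sub (by fun_prop) (by fun_prop), iteratedDeriv_const,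
    iteratedDeriv_fun_pow_zero]
  have h0 : (n.factorial : ℂ) ≠ 0 := mod_cast n.factorial_ne_zero
  rcases eq_or_ne n 0 with rfl | hn
  · simp
  · rcases eq_or_ne n (k + 1) with rfl | hn'
    · simp [h0]
    · simp [hn, hn']

theorem taylorPowerSeries_prod (s : Finset ℕ) :
    taylorPowerSeries (fun q ↦ ∏ k ∈ s, (1 - q ^ (k + 1))) =
      ∏ k ∈ s, (1 - PowerSeries.X ^ (k + 1)) := by
  induction s using Finset.induction_on with
  | empty => simpa using! taylorPowerSeries_one
  | insert a s ha ih =>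
    rw [Finset.prod_insert ha, ← ih, ← taylorPowerSeries_one_sub_pow, ← taylorPowerSeries_mul]
    · congr 1
      funext q
      simp [Finset.prod_insert ha]
    · fun_prop
    · refine Differentiable.analyticAt ?_ 0
      fun_prop

theorem TendstoLocallyUniformlyOn.iteratedDeriv_complex {ι : Type*} {φ : Filter ι} {F : ι → ℂ → ℂ}
    {f : ℂ → ℂ} {U : Set ℂ} (hf : TendstoLocallyUniformlyOn F f φ U)
    (hF : ∀ i, DifferentiableOn ℂ (F i) U) (hU : IsOpen U) (n : ℕ) :
    TendstoLocallyUniformlyOn (fun i ↦ iteratedDeriv n (F i)) (iteratedDeriv n f) φ U := by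
  induction n with
  | zero => simpa using hf
  | succ n ih =>
    simp only [iteratedDeriv_succ]
    refine ih.deriv (Filter.Eventually.of_forall fun i ↦ ?_) hU
    have := ((hF i).contDiffOn hU (n := ⊤)).differentiableOn_iteratedDerivWithin (m := n)
      (by exact_mod_cast WithTop.coe_lt_top _) hU.uniqueDiffOn
    exact this.congr fun x hx ↦ (iteratedDerivWithin_of_isOpen hU hx).symm

theorem taylorPowerSeries_tprod :
    taylorPowerSeries (fun q ↦ ∏' k : ℕ, (1 - q ^ (k + 1))) = PowerSeries.pentagonalSeries ℂ := by
  ext n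
  have h1 := (ModularForm.multipliableLocallyUniformlyOn_one_sub_pow.hasProdLocallyUniformlyOn)
  have h2 : TendstoLocallyUniformlyOn (fun s : Finset ℕ ↦ fun q : ℂ ↦ ∏ k ∈ s, (1 - q ^ (k + 1)))
    (fun q ↦ ∏' k : ℕ, (1 - q ^ (k + 1))) Filter.atTop (Metric.ball 0 1) := by
    exact h1
  have h3 := (h2.iteratedDeriv_complex (fun i ↦ Differentiable.differentiableOn (by fun_prop))
    Metric.isOpen_ball n).tendsto_at (Metric.mem_ball_self one_pos)
  have h4 := h3.const_mul (n.factorial : ℂ)⁻¹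
  rw [taylorPowerSeries, PowerSeries.coeff_mk]
  refine tendsto_nhds_unique h4 (tendsto_nhds_of_eventually_eq ?_)
  filter_upwards [PowerSeries.coeff_prod_one_sub_X_pow_eventually_eq ℂ n] with s hs
  rw [← hs, ← taylorPowerSeries_prod, taylorPowerSeries, PowerSeries.coeff_mk]

theorem hasSum_partitionFn {q : ℂ} (hq : ‖q‖ < 1) :
    HasSum (fun n ↦ (partitionFn n : ℂ) * q ^ n) (∏' k : ℕ, (1 - q ^ (k + 1)))⁻¹ := by
  set P : ℂ → ℂ := fun q ↦ ∏' k : ℕ, (1 - q ^ (k + 1)) with hP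
  have hPd : DifferentiableOn ℂ P (Metric.ball 0 1) :=
    ModularForm.differentiableOn_tprod_one_sub_pow
  have hP0 : ∀ z ∈ Metric.ball (0 : ℂ) 1, P z ≠ 0 := by
    intro z hz
    have hz' : ‖z‖ < 1 := by simpa using hz
    simp only [hP, sub_eq_add_neg]
    refine tprod_one_add_ne_zero_of_summable (fun i h ↦ ?_) ?_
    · have h1 : z ^ (i + 1) = 1 := by linear_combination -h
      have h2 : ‖z‖ ^ (i + 1) = 1 := by rw [← norm_pow, h1, norm_one]
      exact (pow_lt_one₀ (norm_nonneg z) hz' (Nat.succ_ne_zero i)).ne h2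
    · simpa using (summable_nat_add_iff 1).mpr (summable_geometric_of_lt_one (norm_nonneg z) hz')
  have hg : DifferentiableOn ℂ (P⁻¹) (Metric.ball 0 1) := hPd.inv hP0
  have hmem : Metric.ball (0 : ℂ) 1 ∈ nhds 0 := Metric.ball_mem_nhds _ one_pos
  have hT : taylorPowerSeries P⁻¹ * PowerSeries.pentagonalSeries ℂ = 1 := by
    rw [← taylorPowerSeries_tprod, ← taylorPowerSeries_mul (hg.analyticAt hmem)
      (hPd.analyticAt hmem), ← taylorPowerSeries_one]
    refine taylorPowerSeries_congr ?_
    filter_upwards [hmem] with z hz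
    simpa using inv_mul_cancel₀ (hP0 z hz)
  have hT' : taylorPowerSeries P⁻¹ = PowerSeries.mk fun n ↦ (partitionFn n : ℂ) := by
    have h1 := mk_partitionFn_mul_pentagonalSeries
    exact left_inv_eq_right_inv hT (by rw [mul_comm]; exact h1)
  have hs := Complex.hasSum_taylorSeries_on_ball hg (z := q) (by simpa using hq)
  have key (n : ℕ) : (n.factorial : ℂ)⁻¹ • (q - 0) ^ n • iteratedDeriv n P⁻¹ 0 =
      (partitionFn n : ℂ) * q ^ n := by
    have := congrArg (PowerSeries.coeff n) hT'
    simp only [taylorPowerSeries, PowerSeries.coeff_mk] at this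
    rw [← this]
    simp only [smul_eq_mul, sub_zero]
    ring
  simp only [key] at hs
  exact hs

theorem partitionFn_eq_integral (n : ℕ) {y : ℝ} (hy : 0 < y) :
    (partitionFn n : ℂ) = ∫ x in (-(1 / 2) : ℝ)..(1 / 2),
      (ModularForm.eta (x + y * I))⁻¹ * cexp (-2 * π * I * (n - 1 / 24) * (x + y * I)) := by
  set f : ℕ → ℝ → ℂ := fun m x ↦
    (partitionFn m : ℂ) * cexp (2 * π * I * (m - n) * (x + y * I)) with hf
  have hq (x : ℝ) : ‖cexp (2 * π * I * (x + y * I))‖ = rexp (-(2 * π * y)) := by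
    rw [Complex.norm_exp]; simp
  have hq1 : rexp (-(2 * π * y)) < 1 := by
    rw [Real.exp_lt_one_iff]; have := Real.pi_pos; nlinarith [mul_pos this hy]
  have hsum (x : ℝ) : HasSum (fun m ↦ f m x) ((ModularForm.eta (x + y * I))⁻¹ *
      cexp (-2 * π * I * (n - 1 / 24) * (x + y * I))) := by
    have h1 := (hasSum_partitionFn (q := cexp (2 * π * I * (x + y * I)))
      (by rw [hq]; exact hq1)).mul_right (cexp (-2 * π * I * n * (x + y * I)))
    convert! h1 using 1
    · funext m
      simp only [hf]
      rw [← Complex.exp_nat_mul, mul_assoc (partitionFn m : ℂ), ← Complex.exp_add]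
      congr 2
      ring
    · simp only [ModularForm.eta, ModularForm.eta_q_eq_pow, mul_inv, Function.Periodic.qParam]
      rw [← Complex.exp_neg, mul_right_comm, mul_comm, ← Complex.exp_add]
      congr 2
      push_cast
      ring
  have hnorm (m : ℕ) (x : ℝ) :
      ‖f m x‖ = (partitionFn m : ℝ) * rexp (-(2 * π * y)) ^ m * rexp (2 * π * n * y) := by
    rw [hf, norm_mul, Complex.norm_natCast, Complex.norm_exp, mul_assoc (partitionFn m : ℝ),
      ← Real.exp_nat_mul, ← Real.exp_add]
    congr 2
    simp
    ring
  have hbd : Summable fun m ↦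
      (partitionFn m : ℝ) * rexp (-(2 * π * y)) ^ m * rexp (2 * π * n * y) := by
    have := (hsum 0).summable.norm
    simpa only [hnorm] using this
  have hsum_int := intervalIntegral.hasSum_integral_of_dominated_convergence (F := f)
    (a := (-(1 / 2) : ℝ)) (b := 1 / 2) (μ := MeasureTheory.volume)
    (fun m _ ↦ (partitionFn m : ℝ) * rexp (-(2 * π * y)) ^ m * rexp (2 * π * n * y))
    (fun m ↦ Continuous.aestronglyMeasurable (by rw [hf]; fun_prop))
    (fun m ↦ .of_forall fun x _ ↦ (hnorm m x).le)
    (.of_forall fun x _ ↦ hbd)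
    (by simp)
    (.of_forall fun x _ ↦ hsum x)
  have hterm (m : ℕ) : ∫ x in (-(1 / 2) : ℝ)..(1 / 2), f m x =
      if m = n then (partitionFn n : ℂ) else 0 := by
    split_ifs with h
    · subst h
      simp [hf]
      norm_num
    · have hc : (2 * π * I * ((m : ℂ) - n)) ≠ 0 := by
        have : (m : ℂ) - n ≠ 0 := sub_ne_zero.mpr (mod_cast h)
        simp [Real.pi_ne_zero, this]
      have h1 (x : ℝ) : f m x = ((partitionFn m : ℂ) * cexp (2 * π * I * (m - n) * (y * I))) *
          cexp ((2 * π * I * ((m : ℂ) - n)) * x) := by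
        simp only [hf]
        rw [mul_assoc (partitionFn m : ℂ), ← Complex.exp_add]
        congr 2
        ring
      simp only [h1]
      rw [intervalIntegral.integral_const_mul, integral_exp_mul_complex hc]
      have h2 : cexp ((2 * π * I * ((m : ℂ) - n)) * ((1 / 2 : ℝ) : ℂ)) =
          cexp ((2 * π * I * ((m : ℂ) - n)) * ((-(1 / 2) : ℝ) : ℂ)) := by
        rw [Complex.exp_eq_exp_iff_exists_int]
        refine ⟨(m : ℤ) - n, ?_⟩
        push_cast
        ring
      rw [h2]
      simp
  simp only [hterm] at hsum_int
  exact (hasSum_ite_eq n (partitionFn n : ℂ)).unique hsum_int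

theorem norm_tprod_one_sub_pow_sub_one_le {q : ℂ} (hq : ‖q‖ ≤ 1 / 500) :
    ‖∏' k : ℕ, (1 - q ^ (k + 1)) - 1‖ ≤ 2 * ‖q‖ := by
  have hr0 := norm_nonneg q
  have hr1 : ‖q‖ < 1 := by linarith
  have hP := (ModularForm.multipliable_one_sub_pow hr1).hasProd
  have hS : HasSum (fun k : ℕ ↦ ‖q‖ ^ (k + 1)) (‖q‖ * (1 - ‖q‖)⁻¹) := by
    simpa [pow_succ'] using (hasSum_geometric_of_lt_one hr0 hr1).mul_left ‖q‖
  have h1 : ‖∏' k : ℕ, (1 - q ^ (k + 1)) - 1‖ ≤ rexp (‖q‖ * (1 - ‖q‖)⁻¹) - 1 := by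
    refine le_of_tendsto (hP.sub_const 1).norm (.of_forall fun s ↦ ?_)
    have h2 := Finset.norm_prod_one_add_sub_one_le s (fun k : ℕ ↦ -q ^ (k + 1))
    simp only [← sub_eq_add_neg, norm_neg, norm_pow] at h2
    refine h2.trans (sub_le_sub_right (Real.exp_le_exp.mpr ?_) 1)
    exact sum_le_hasSum s (fun k _ ↦ by positivity) hS
  have h3 : ‖q‖ * (1 - ‖q‖)⁻¹ ≤ ‖q‖ * (500 / 499) := by
    refine mul_le_mul_of_nonneg_left ?_ hr0
    rw [inv_le_comm₀ (by linarith) (by norm_num)]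
    norm_num
    linarith
  have h4 : 0 ≤ ‖q‖ * (1 - ‖q‖)⁻¹ := mul_nonneg hr0 (inv_nonneg.mpr (by linarith))
  have h5 := Real.abs_exp_sub_one_sub_id_le (x := ‖q‖ * (1 - ‖q‖)⁻¹)
    (by rw [abs_of_nonneg h4]; nlinarith)
  have h6 := (abs_le.mp h5).2
  nlinarith

theorem norm_tprod_one_sub_pow_ge {q : ℂ} (hq : ‖q‖ < 1) :
    ‖∏' k : ℕ, (1 - (‖q‖ : ℂ) ^ (k + 1))‖ ≤ ‖∏' k : ℕ, (1 - q ^ (k + 1))‖ := by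
  have hr : ‖(‖q‖ : ℂ)‖ < 1 := by simpa using hq
  refine le_of_tendsto_of_tendsto (ModularForm.multipliable_one_sub_pow hr).hasProd.norm
    (ModularForm.multipliable_one_sub_pow hq).hasProd.norm (.of_forall fun s ↦ ?_)
  beta_reduce
  refine Finset.prod_le_prod (fun _ _ ↦ norm_nonneg _) fun k _ ↦ ?_
  have h1 : ‖q‖ ^ (k + 1) ≤ 1 := pow_le_one₀ (norm_nonneg q) hq.le
  have h2 : ‖(1 - (‖q‖ : ℂ) ^ (k + 1))‖ = 1 - ‖q‖ ^ (k + 1) := by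
    rw [← Complex.ofReal_pow, ← Complex.ofReal_one, ← Complex.ofReal_sub, Complex.norm_real,
      Real.norm_of_nonneg (by linarith)]
  rw [h2, ← norm_pow, ← norm_one (α := ℂ)]
  exact norm_sub_norm_le _ _

theorem eta_eq_exp_mul_tprod (τ : ℂ) :
    ModularForm.eta τ = cexp (2 * π * I * τ / 24) *
      ∏' k : ℕ, (1 - cexp (2 * π * I * τ) ^ (k + 1)) := by
  simp [ModularForm.eta, ModularForm.eta_q_eq_pow, Function.Periodic.qParam]

theorem norm_exp_two_pi_I_mul (τ : ℂ) : ‖cexp (2 * π * I * τ)‖ = rexp (-(2 * π * τ.im)) := by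
  rw [Complex.norm_exp]; simp

theorem norm_eta_eq (τ : ℂ) : ‖ModularForm.eta τ‖ = rexp (-(π * τ.im / 12)) *
    ‖∏' k : ℕ, (1 - cexp (2 * π * I * τ) ^ (k + 1))‖ := by
  rw [eta_eq_exp_mul_tprod, norm_mul, show 2 * π * I * τ / 24 = 2 * π * I * (τ / 24) by ring,
    norm_exp_two_pi_I_mul]
  congr 3
  rw [show (24 : ℂ) = ((24 : ℝ) : ℂ) by norm_num, Complex.div_ofReal_im]
  ring

theorem norm_eta_add_one (τ : ℂ) : ‖ModularForm.eta (τ + 1)‖ = ‖ModularForm.eta τ‖ := by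
  rw [norm_eta_eq, norm_eta_eq, mul_add, mul_one, Complex.exp_add, Complex.exp_two_pi_mul_I]
  simp

theorem norm_sqrt_eq (z : ℂ) : ‖Complex.sqrt z‖ = √‖z‖ := by
  have h : Complex.sqrt z ^ 2 = z := by
    rw [Complex.sqrt, ← Complex.cpow_nat_mul]; simp
  rw [← h, norm_pow, Real.sqrt_sq (norm_nonneg _), h]

theorem norm_eta_neg_inv {τ : ℂ} (hτ : 0 < τ.im) :
    ‖ModularForm.eta (-1 / τ)‖ = √‖τ‖ * ‖ModularForm.eta τ‖ := by
  have h := ModularForm.eta_comp_eq_csqrt_I_inv (x := τ) hτ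
  simp only [Function.comp_apply, Pi.smul_apply, Pi.mul_apply, smul_eq_mul] at h
  rw [h, norm_mul, norm_mul, norm_inv, norm_sqrt_eq, norm_sqrt_eq]
  simp

theorem norm_eta_im_mul_I_le {τ : ℂ} (hτ : 0 < τ.im) :
    ‖ModularForm.eta (τ.im * I)‖ ≤ ‖ModularForm.eta τ‖ := by
  rw [norm_eta_eq, norm_eta_eq τ]
  have h1 : cexp (2 * π * I * (τ.im * I)) = (‖cexp (2 * π * I * τ)‖ : ℂ) := by
    rw [norm_exp_two_pi_I_mul, Complex.ofReal_exp]
    congr 1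
    push_cast
    linear_combination 2 * π * τ.im * I_sq
  rw [h1]
  have h2 : ((τ.im : ℂ) * I).im = τ.im := by simp
  rw [h2]
  refine mul_le_mul_of_nonneg_left (norm_tprod_one_sub_pow_ge ?_) (Real.exp_pos _).le
  rw [norm_exp_two_pi_I_mul, Real.exp_lt_one_iff]
  have := mul_pos Real.pi_pos hτ
  linarith

theorem exp_neg_two_pi_mul_le {Y : ℝ} (hY : 1 ≤ Y) : rexp (-(2 * π * Y)) ≤ 1 / 500 := by
  have h1 : rexp (-(2 * π * Y)) ≤ rexp (-(6.28 : ℝ)) := by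
    rw [Real.exp_le_exp]
    nlinarith [Real.pi_gt_d2]
  refine h1.trans ?_
  rw [Real.exp_neg, one_div]
  refine inv_anti₀ (by norm_num) ?_
  have h2 : rexp 6.28 = rexp 1 ^ 6 * rexp 0.28 := by
    rw [← Real.exp_nat_mul, ← Real.exp_add]; norm_num
  have h3 := Real.exp_one_gt_d9
  have h4 : (1.28 : ℝ) ≤ rexp 0.28 := by
    have := Real.add_one_le_exp (0.28 : ℝ); linarith
  have h5 : (2.718 : ℝ) ^ 6 ≤ rexp 1 ^ 6 := by gcongr; linarith
  rw [h2]
  nlinarith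

theorem inv_norm_eta_le_of_one_le {τ : ℂ} (hτ : 1 ≤ τ.im) :
    ‖ModularForm.eta τ‖⁻¹ ≤ 1.01 * rexp (π * τ.im / 12) := by
  have h0 := exp_neg_two_pi_mul_le hτ
  have h1 := norm_tprod_one_sub_pow_sub_one_le (q := cexp (2 * π * I * τ))
    (by rw [norm_exp_two_pi_I_mul]; exact h0)
  rw [norm_exp_two_pi_I_mul] at h1
  have h2 : (249 : ℝ) / 250 ≤ ‖∏' k : ℕ, (1 - cexp (2 * π * I * τ) ^ (k + 1))‖ := by
    have := norm_sub_norm_le 1 (∏' k : ℕ, (1 - cexp (2 * π * I * τ) ^ (k + 1)))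
    rw [norm_one, norm_sub_rev] at this
    linarith
  rw [norm_eta_eq, mul_inv, ← Real.exp_neg, neg_neg, mul_comm]
  refine mul_le_mul_of_nonneg_right ?_ (Real.exp_pos _).le
  rw [inv_le_comm₀ (by linarith) (by norm_num)]
  refine le_trans ?_ h2
  norm_num

/-- An upper bound for `1 / |η|` that is symmetric under `Im τ ↦ 1 / Im τ`. -/
theorem inv_norm_eta_le {τ : ℂ} {T : ℝ} (hτ : 0 < τ.im) (h1 : τ.im ≤ T)
    (h2 : 1 / τ.im ≤ T) : ‖ModularForm.eta τ‖⁻¹ ≤ 1.01 * rexp (π * T / 12) := by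
  rcases le_total 1 τ.im with h | h
  · refine (inv_norm_eta_le_of_one_le h).trans ?_
    gcongr
  · have h3 : 0 < ((τ.im : ℂ) * I).im := by simpa using hτ
    have h4 : -1 / ((τ.im : ℂ) * I) = ((1 / τ.im : ℝ) : ℂ) * I := by
      have : (τ.im : ℂ) ≠ 0 := mod_cast hτ.ne'
      push_cast
      field_simp
      rw [I_sq]
    have h5 := norm_eta_neg_inv h3
    have h6 : ‖((τ.im : ℂ) * I)‖ = τ.im := by simp [hτ.le]
    rw [h4, h6] at h5
    have h7 : ‖ModularForm.eta (((1 / τ.im : ℝ) : ℂ) * I)‖ ≤ ‖ModularForm.eta τ‖ := by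
      rw [h5]
      calc √τ.im * ‖ModularForm.eta (τ.im * I)‖ ≤ 1 * ‖ModularForm.eta (τ.im * I)‖ := by
            gcongr
            exact Real.sqrt_le_one.mpr h
        _ ≤ _ := by rw [one_mul]; exact norm_eta_im_mul_I_le hτ
    have h8 : 0 < ‖ModularForm.eta (((1 / τ.im : ℝ) : ℂ) * I)‖ := by
      refine norm_pos_iff.mpr (ModularForm.eta_ne_zero ?_)
      show 0 < (((1 / τ.im : ℝ) : ℂ) * I).im
      simpa using hτ
    have h9 : (((1 / τ.im : ℝ) : ℂ) * I).im = 1 / τ.im := by simp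
    have h10 := inv_norm_eta_le_of_one_le (τ := ((1 / τ.im : ℝ) : ℂ) * I)
      (by rw [h9, le_div_iff₀ hτ]; linarith)
    rw [h9] at h10
    refine (inv_anti₀ h8 h7).trans (h10.trans ?_)
    gcongr

theorem inv_norm_eta_le_of_two_mul_sub_one {τ : ℂ} {T : ℝ} (hτ : 0 < τ.im)
    (h1 : τ.im ≤ T * ‖2 * τ - 1‖ ^ 2) (h2 : ‖2 * τ - 1‖ ^ 2 ≤ T * τ.im) :
    ‖ModularForm.eta τ‖⁻¹ ≤ √‖2 * τ - 1‖ * (1.01 * rexp (π * T / 12)) := by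
  have hτ0 : τ ≠ 0 := by rintro rfl; simp at hτ
  have hw0 : 2 * τ - 1 ≠ 0 := by
    intro h
    have := congrArg Complex.im h
    simp at this
    linarith
  have him (w : ℂ) : (-1 / w).im = w.im / ‖w‖ ^ 2 := by
    rw [neg_div, Complex.neg_im, one_div, Complex.inv_im, Complex.normSq_eq_norm_sq]
    ring
  set σ : ℂ := -1 / τ + 2 with hσ
  have hσ' : σ = (2 * τ - 1) / τ := by rw [hσ]; field_simp; ring
  have hσn : ‖σ‖ = ‖2 * τ - 1‖ / ‖τ‖ := by rw [hσ', norm_div]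
  have hn : 0 < ‖τ‖ := norm_pos_iff.mpr hτ0
  have hw : 0 < ‖2 * τ - 1‖ := norm_pos_iff.mpr hw0
  have hσim : σ.im = τ.im / ‖τ‖ ^ 2 := by rw [hσ, Complex.add_im, him]; simp
  have hσpos : 0 < σ.im := by rw [hσim]; positivity
  have him' : (-1 / σ).im = τ.im / ‖2 * τ - 1‖ ^ 2 := by
    rw [him, hσim, hσn]
    field_simp
  have e1 := norm_eta_neg_inv hσpos
  have e2 := norm_eta_neg_inv hτ
  have e3 : ‖ModularForm.eta σ‖ = ‖ModularForm.eta (-1 / τ)‖ := by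
    rw [hσ, show -1 / τ + 2 = (-1 / τ + 1) + 1 by ring, norm_eta_add_one, norm_eta_add_one]
  have e4 : ‖ModularForm.eta (-1 / σ)‖ = √‖2 * τ - 1‖ * ‖ModularForm.eta τ‖ := by
    rw [e1, e3, e2, hσn, ← mul_assoc, ← Real.sqrt_mul (by positivity), div_mul_cancel₀ _ hn.ne']
  have hs : 0 < √‖2 * τ - 1‖ := Real.sqrt_pos.mpr hw
  have e5 : ‖ModularForm.eta τ‖⁻¹ = √‖2 * τ - 1‖ * ‖ModularForm.eta (-1 / σ)‖⁻¹ := by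
    rw [e4, mul_inv, ← mul_assoc, mul_inv_cancel₀ hs.ne', one_mul]
  rw [e5]
  refine mul_le_mul_of_nonneg_left (inv_norm_eta_le ?_ ?_ ?_) hs.le
  · rw [him']; positivity
  · rw [him', div_le_iff₀ (by positivity)]; exact h1
  · rw [him', one_div_div, div_le_iff₀ hτ]; exact h2

theorem sqrt_neg_I_mul {τ : ℂ} (hτ : 0 < τ.im) :
    Complex.sqrt (-I * τ) = (Complex.sqrt I)⁻¹ * Complex.sqrt τ := by
  have hτ0 : τ ≠ 0 := by rintro rfl; simp at hτ
  have harg : 0 ≤ τ.arg := Complex.arg_nonneg_iff.mpr hτ.le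
  have hlog : Complex.log (-I * τ) = Complex.log (-I) + Complex.log τ := by
    rw [Complex.log_mul_eq_add_log_iff (by simp) hτ0]
    simp only [Complex.arg_neg_I, Set.mem_Ioc]
    constructor <;> linarith [Real.pi_pos, Complex.arg_le_pi τ]
  have hI : Complex.log (-I) = -Complex.log I := by rw [Complex.log_neg_I, Complex.log_I]; ring
  rw [_root_.sqrt_eq_exp (by simp [hτ0]), _root_.sqrt_eq_exp I_ne_zero,
    _root_.sqrt_eq_exp hτ0, ← Complex.exp_neg, ← Complex.exp_add, hlog, hI]
  congr 1
  ring

theorem norm_inv_eta_sub_le {τ : ℂ} {T : ℝ} (hτ : 0 < τ.im) (hT : 1 ≤ T)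
    (h2 : ‖τ‖ ^ 2 ≤ T * τ.im) :
    ‖(ModularForm.eta τ)⁻¹ - Complex.sqrt (-I * τ) * cexp (2 * π * I / (24 * τ))‖ ≤
      √‖τ‖ * (2.02 * rexp (π * T / 12)) := by
  have hτ0 : τ ≠ 0 := by rintro rfl; simp at hτ
  have hn : 0 < ‖τ‖ := norm_pos_iff.mpr hτ0
  have him : (-1 / τ).im = τ.im / ‖τ‖ ^ 2 := by
    rw [neg_div, Complex.neg_im, one_div, Complex.inv_im, Complex.normSq_eq_norm_sq]
    ring
  set Y := (-1 / τ).im with hY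
  have hYpos : 0 < Y := by rw [him]; positivity
  have h := ModularForm.eta_comp_eq_csqrt_I_inv (x := τ) hτ
  simp only [Function.comp_apply, Pi.smul_apply, Pi.mul_apply, smul_eq_mul] at h
  rw [← mul_assoc, ← sqrt_neg_I_mul hτ] at h
  set s := Complex.sqrt (-I * τ) with hs
  have hsn : ‖s‖ = √‖τ‖ := by rw [hs, norm_sqrt_eq]; simp
  have hs0 : s ≠ 0 := by rw [← norm_pos_iff, hsn]; positivity
  have e1 : (ModularForm.eta τ)⁻¹ = s * (ModularForm.eta (-1 / τ))⁻¹ := by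
    rw [h, mul_inv, ← mul_assoc, mul_inv_cancel₀ hs0, one_mul]
  rw [e1, ← mul_sub, norm_mul, hsn]
  refine mul_le_mul_of_nonneg_left ?_ (Real.sqrt_nonneg _)
  have hexp : cexp (2 * π * I / (24 * τ)) = (cexp (2 * π * I * (-1 / τ) / 24))⁻¹ := by
    rw [← Complex.exp_neg]
    congr 1
    field_simp
  have hexpn : ‖cexp (2 * π * I / (24 * τ))‖ = rexp (π * Y / 12) := by
    rw [hexp, norm_inv, show 2 * π * I * (-1 / τ) / 24 = 2 * π * I * ((-1 / τ) / (24 : ℝ)) by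
      push_cast; ring, norm_exp_two_pi_I_mul, Complex.div_ofReal_im, ← Real.exp_neg]
    congr 1
    ring
  rcases le_total 1 Y with h1 | h1
  · have h0 := exp_neg_two_pi_mul_le h1
    have h3 := norm_tprod_one_sub_pow_sub_one_le (q := cexp (2 * π * I * (-1 / τ)))
      (by rw [norm_exp_two_pi_I_mul]; exact h0)
    rw [norm_exp_two_pi_I_mul, ← hY] at h3
    rw [eta_eq_exp_mul_tprod, mul_inv, ← hexp]
    set P := ∏' k : ℕ, (1 - cexp (2 * π * I * (-1 / τ)) ^ (k + 1)) with hP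
    have h4 : (249 : ℝ) / 250 ≤ ‖P‖ := by
      have := norm_sub_norm_le 1 P
      rw [norm_one, norm_sub_rev] at this
      linarith
    have hP0 : P ≠ 0 := by rw [← norm_pos_iff]; linarith
    have e2 : cexp (2 * π * I / (24 * τ)) * P⁻¹ - cexp (2 * π * I / (24 * τ)) =
        -(cexp (2 * π * I / (24 * τ)) * ((P - 1) / P)) := by
      field_simp; ring
    rw [e2, norm_neg, norm_mul, norm_div, hexpn]
    have h5 : ‖P - 1‖ / ‖P‖ ≤ 2.02 * rexp (-(2 * π * Y)) := by
      rw [div_le_iff₀ (by linarith)]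
      nlinarith [Real.exp_pos (-(2 * π * Y))]
    calc rexp (π * Y / 12) * (‖P - 1‖ / ‖P‖)
        ≤ rexp (π * Y / 12) * (2.02 * rexp (-(2 * π * Y))) := by gcongr
      _ = 2.02 * rexp (π * Y / 12 + -(2 * π * Y)) := by rw [Real.exp_add]; ring
      _ ≤ 2.02 * rexp (π * T / 12) := by
        gcongr
        nlinarith [mul_pos Real.pi_pos hYpos, Real.pi_pos]
  · have hYT : 1 / Y ≤ T := by rw [him, one_div_div, div_le_iff₀ hτ]; exact h2
    have h3 := inv_norm_eta_le (τ := -1 / τ) hYpos (h1.trans hT) hYT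
    refine (norm_sub_le _ _).trans ?_
    rw [norm_inv, hexpn]
    have : rexp (π * Y / 12) ≤ rexp (π * T / 12) := by
      gcongr
      exact h1.trans hT
    linarith [Real.exp_pos (π * T / 12)]

/-- The half-line Fourier transform of a Gaussian, `√π / 2` times the Faddeeva function. -/
noncomputable def faddeevaInt (v : ℂ) : ℂ := ∫ t : ℝ in Ioi 0, cexp (2 * I * v * t - t ^ 2)

theorem integrable_cexp_mul_sub_sq (c : ℂ) : Integrable fun t : ℝ ↦ cexp (c * t - t ^ 2) := by
  have h := integrable_cexp_quadratic (b := 1) (by simp) c 0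
  refine h.congr (.of_forall fun t ↦ ?_)
  simp only
  congr 1
  ring

theorem integrable_mul_cexp_mul_sub_sq (c : ℂ) :
    IntegrableOn (fun t : ℝ ↦ (t : ℂ) * cexp (c * t - t ^ 2)) (Ioi 0) := by
  have hc : Continuous fun t : ℝ ↦ (t : ℂ) * cexp (c * t - t ^ 2) := by fun_prop
  refine Integrable.mono (integrable_cexp_mul_sub_sq (c + 1)).integrableOn
    hc.aestronglyMeasurable ?_
  refine (ae_restrict_iff' measurableSet_Ioi).mpr (.of_forall fun t (ht : 0 < t) ↦ ?_)
  rw [show (c + 1) * t - (t : ℂ) ^ 2 = t + (c * t - t ^ 2) by ring, Complex.exp_add, norm_mul,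
    norm_mul, ← Complex.ofReal_exp, Complex.norm_real, Complex.norm_real,
    Real.norm_of_nonneg ht.le, Real.norm_of_nonneg (Real.exp_pos t).le]
  gcongr
  linarith [Real.add_one_le_exp t]

theorem integral_two_mul_cexp_mul_sub_sq (c : ℂ) :
    ∫ t : ℝ in Ioi 0, 2 * (t * cexp (c * t - t ^ 2)) =
      c * (∫ t : ℝ in Ioi 0, cexp (c * t - t ^ 2)) + 1 := by
  have hi1 := (integrable_cexp_mul_sub_sq c).integrableOn (s := Ioi 0)
  have hi2 := integrable_mul_cexp_mul_sub_sq c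
  have hderiv (t : ℝ) : HasDerivAt (fun t : ℝ ↦ cexp (c * t - t ^ 2))
      (c * cexp (c * t - t ^ 2) - 2 * (t * cexp (c * t - t ^ 2))) t := by
    have h1 : HasDerivAt (fun z : ℂ ↦ cexp (c * z - z ^ 2))
        (cexp (c * t - t ^ 2) * (c * 1 - 2 * (t : ℂ))) t := by
      refine HasDerivAt.cexp (((hasDerivAt_id _).const_mul c).sub ?_)
      simpa using hasDerivAt_pow 2 (t : ℂ)
    convert! h1.comp_ofReal using 1
    ring
  have hlim : Tendsto (fun t : ℝ ↦ cexp (c * t - t ^ 2)) atTop (𝓝 0) := by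
    rw [tendsto_zero_iff_norm_tendsto_zero]
    simp only [Complex.norm_exp]
    refine Real.tendsto_exp_atBot.comp ?_
    have h1 (t : ℝ) : (c * t - (t : ℂ) ^ 2).re = t * (c.re + -t) := by
      rw [← Complex.ofReal_pow, Complex.sub_re, Complex.ofReal_re]; simp; ring
    simp only [h1]
    exact tendsto_id.atTop_mul_atBot₀ (tendsto_atBot_add_const_left _ _ tendsto_neg_atTop_atBot)
  have h := integral_Ioi_of_hasDerivAt_of_tendsto' (a := (0 : ℝ)) (fun t _ ↦ hderiv t)
    ((hi1.const_mul c).sub (hi2.const_mul 2)) hlim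
  rw [integral_sub (hi1.const_mul c) (hi2.const_mul 2), integral_const_mul c] at h
  simp at h
  simp only [integral_const_mul] at h ⊢
  linear_combination -h

theorem hasDerivAt_faddeevaInt (v : ℂ) :
    HasDerivAt faddeevaInt (I - 2 * v * faddeevaInt v) v := by
  have hd (t : ℝ) (w : ℂ) : HasDerivAt (fun w : ℂ ↦ cexp (2 * I * w * t - t ^ 2))
      (I * (2 * (t * cexp (2 * I * w * t - t ^ 2)))) w := by
    have h1 : HasDerivAt (fun w : ℂ ↦ cexp (2 * I * w * t - t ^ 2))
        (cexp (2 * I * w * t - t ^ 2) * (2 * I * 1 * t)) w :=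
      ((((hasDerivAt_id w).const_mul (2 * I)).mul_const (t : ℂ)).sub_const _).cexp
    convert! h1 using 1
    ring
  have hR := (integrable_mul_cexp_mul_sub_sq ((2 * (‖v‖ + 1) : ℝ) : ℂ)).norm.const_mul 2
  have h := hasDerivAt_integral_of_dominated_loc_of_deriv_le
    (μ := volume.restrict (Ioi 0)) (F := fun w (t : ℝ) ↦ cexp (2 * I * w * t - t ^ 2))
    (F' := fun w (t : ℝ) ↦ I * (2 * (t * cexp (2 * I * w * t - t ^ 2))))
    (x₀ := v) (s := Metric.ball v 1)
    (bound := fun t : ℝ ↦ 2 * ‖(t : ℂ) * cexp (((2 * (‖v‖ + 1) : ℝ) : ℂ) * t - t ^ 2)‖)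
    (Metric.ball_mem_nhds v one_pos)
    (.of_forall fun w ↦ Continuous.aestronglyMeasurable (by fun_prop))
    ((integrable_cexp_mul_sub_sq (2 * I * v)).integrableOn)
    (Continuous.aestronglyMeasurable (by fun_prop))
    ((ae_restrict_iff' measurableSet_Ioi).mpr (.of_forall fun t (ht : 0 < t) w hw ↦ ?_))
    hR (.of_forall fun t w _ ↦ hd t w)
  · have h2 := h.2
    rw [integral_const_mul, integral_two_mul_cexp_mul_sub_sq] at h2
    convert! h2 using 1
    simp only [faddeevaInt]
    linear_combination (-2 * v * ∫ t : ℝ in Ioi 0, cexp (2 * I * v * t - t ^ 2)) * I_sq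
  · have hw' : ‖w‖ ≤ ‖v‖ + 1 := by
      have := norm_sub_norm_le w v
      rw [Metric.mem_ball, dist_eq_norm] at hw
      linarith
    simp only [norm_mul, norm_I, one_mul, Complex.norm_ofNat]
    gcongr 2 * (_ * ?_)
    rw [Complex.norm_exp, Complex.norm_exp, Real.exp_le_exp, Complex.sub_re, Complex.sub_re]
    refine sub_le_sub_right ?_ _
    have h1 : (2 * I * w * t).re = 2 * (-w.im) * t := by simp
    rw [h1, ← Complex.ofReal_mul, Complex.ofReal_re]
    gcongr
    exact (neg_le_abs _).trans ((Complex.abs_im_le_norm w).trans hw')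

theorem faddeevaInt_add_neg (v : ℂ) :
    faddeevaInt v + faddeevaInt (-v) = √π * cexp (-v ^ 2) := by
  have h1 : faddeevaInt (-v) = ∫ t : ℝ in Iic 0, cexp (2 * I * v * t - t ^ 2) := by
    have := integral_comp_neg_Ioi (0 : ℝ) (fun t : ℝ ↦ cexp (2 * I * v * t - t ^ 2))
    rw [neg_zero] at this
    rw [← this, faddeevaInt]
    congr 1
    funext t
    push_cast
    ring_nf
  have hi := integrable_cexp_mul_sub_sq (2 * I * v)
  have h2 := integral_cexp_quadratic (b := -1) (by simp) (2 * I * v) 0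
  rw [h1, add_comm, faddeevaInt, intervalIntegral.integral_Iic_add_Ioi hi.integrableOn
    hi.integrableOn]
  convert! h2 using 1
  · congr 1
    funext t
    congr 1
    ring
  · rw [Real.sqrt_eq_rpow, Complex.ofReal_cpow pi_pos.le]
    congr 2
    · norm_num
    · norm_num
    · linear_combination -v ^ 2 * I_sq

theorem norm_faddeevaInt_le {v : ℂ} (hv : 0 ≤ v.im) : ‖faddeevaInt v‖ ≤ 1 := by
  have h1 : ‖faddeevaInt v‖ ≤ ∫ t : ℝ in Ioi 0, rexp (-1 * t ^ 2) := by
    refine norm_integral_le_of_norm_le (integrable_exp_neg_mul_sq one_pos).integrableOn ?_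
    refine (ae_restrict_iff' measurableSet_Ioi).mpr (.of_forall fun t (ht : 0 < t) ↦ ?_)
    rw [Complex.norm_exp, Real.exp_le_exp, Complex.sub_re, ← Complex.ofReal_pow,
      Complex.ofReal_re]
    have h1 : (2 * I * v * t).re = -(2 * (v.im * t)) := by simp; ring
    rw [h1]
    have := mul_nonneg hv ht.le
    linarith
  refine h1.trans ?_
  rw [integral_gaussian_Ioi, div_one, div_le_one two_pos, Real.sqrt_le_left two_pos.le]
  linarith [Real.pi_lt_four]

/-- A primitive of `2 s² exp (α² / s² + β² s²)` whenever `V' = I - 2 v V`. -/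
noncomputable def gaussPrimitive (V : ℂ → ℂ) (α β s : ℂ) : ℂ :=
  cexp (α ^ 2 / s ^ 2 + β ^ 2 * s ^ 2) / β ^ 2 *
    (s - I * (α - 1 / (2 * β)) * V (β * s - α / s) + I * (α + 1 / (2 * β)) * V (β * s + α / s))

theorem hasDerivAt_gaussPrimitive {V : ℂ → ℂ} (hV : ∀ v, HasDerivAt V (I - 2 * v * V v) v)
    (α : ℂ) {β s : ℂ} (hβ : β ≠ 0) (hs : s ≠ 0) :
    HasDerivAt (gaussPrimitive V α β)
      (2 * s ^ 2 * cexp (α ^ 2 / s ^ 2 + β ^ 2 * s ^ 2)) s := by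
  have hinv : HasDerivAt (fun s : ℂ ↦ α / s) (-α / s ^ 2) s := by
    convert! (hasDerivAt_inv hs).const_mul α using 1
    ring
  have hid : HasDerivAt (fun s : ℂ ↦ β * s) β s := by
    simpa using (hasDerivAt_id s).const_mul β
  have hG : HasDerivAt (fun s : ℂ ↦ cexp (α ^ 2 / s ^ 2 + β ^ 2 * s ^ 2))
      (cexp (α ^ 2 / s ^ 2 + β ^ 2 * s ^ 2) * (-2 * α ^ 2 / s ^ 3 + 2 * β ^ 2 * s)) s := by
    have h := ((hinv.pow 2).add (hid.pow 2)).cexp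
    convert! h using 1
    · funext s
      simp only [Pi.add_apply, Pi.pow_apply, div_pow, mul_pow]
    · simp only [Pi.add_apply, Pi.pow_apply, div_pow, mul_pow]
      congr 1
      push_cast
      field_simp
  have hm : HasDerivAt (fun s : ℂ ↦ V (β * s - α / s))
      ((I - 2 * (β * s - α / s) * V (β * s - α / s)) * (β - -α / s ^ 2)) s :=
    (hV _).comp s (hid.sub hinv)
  have hp : HasDerivAt (fun s : ℂ ↦ V (β * s + α / s))
      ((I - 2 * (β * s + α / s) * V (β * s + α / s)) * (β + -α / s ^ 2)) s :=
    (hV _).comp s (hid.add hinv)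
  have h := (hG.div_const (β ^ 2)).mul (((hasDerivAt_id s).sub
    (hm.const_mul (I * (α - 1 / (2 * β))))).add (hp.const_mul (I * (α + 1 / (2 * β)))))
  convert! h using 1
  simp only [Pi.add_apply, Pi.sub_apply, id]
  generalize cexp (α ^ 2 / s ^ 2 + β ^ 2 * s ^ 2) = E
  generalize V (β * s - α / s) = A
  generalize V (β * s + α / s) = B
  field_simp
  ring_nf
  simp only [I_sq]
  ring

theorem norm_gaussPrimitive_le {V : ℂ → ℂ} {α β : ℝ} {s : ℂ} (hα : 0 < α) (hβ : 0 < β)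
    (h1 : ‖V (β * s - α / s)‖ ≤ 1) (h2 : ‖V (β * s + α / s)‖ ≤ 1) :
    ‖gaussPrimitive V α β s‖ ≤ rexp (α ^ 2 / s ^ 2 + β ^ 2 * s ^ 2 : ℂ).re / β ^ 2 *
      (‖s‖ + 2 * α + 1 / β) := by
  have hβ' : ‖((β : ℂ) ^ 2)‖ = β ^ 2 := by simp
  have e1 : ‖(α - 1 / (2 * β) : ℂ)‖ ≤ α + 1 / (2 * β) := by
    refine (norm_sub_le _ _).trans_eq ?_
    simp [abs_of_pos hα, abs_of_pos hβ]
  have e2 : ‖(α + 1 / (2 * β) : ℂ)‖ ≤ α + 1 / (2 * β) := by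
    refine (norm_add_le _ _).trans_eq ?_
    simp [abs_of_pos hα, abs_of_pos hβ]
  rw [gaussPrimitive, norm_mul, norm_div, Complex.norm_exp, hβ']
  refine mul_le_mul_of_nonneg_left ?_ (by positivity)
  refine (norm_add_le _ _).trans ?_
  refine (add_le_add_left (norm_sub_le _ _) _).trans ?_
  simp only [norm_mul, norm_I, one_mul]
  have e3 : ‖(α - 1 / (2 * β) : ℂ)‖ * ‖V (β * s - α / s)‖ ≤ (α + 1 / (2 * β)) * 1 := by gcongr
  have e4 : ‖(α + 1 / (2 * β) : ℂ)‖ * ‖V (β * s + α / s)‖ ≤ (α + 1 / (2 * β)) * 1 := by gcongr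
  have e5 : 1 / β = 2 * (1 / (2 * β)) := by field_simp
  rw [e5]
  linarith

theorem im_ofReal_mul_add_div (β α : ℝ) (s : ℂ) :
    (β * s + α / s).im = s.im * (β - α / ‖s‖ ^ 2) := by
  rw [Complex.add_im, Complex.im_ofReal_mul, div_eq_mul_inv, Complex.im_ofReal_mul,
    Complex.inv_im, Complex.normSq_eq_norm_sq]
  ring

theorem gaussPrimitive_faddeevaInt_sub {α β : ℝ} {s : ℂ} (hs : s ≠ 0) :
    gaussPrimitive faddeevaInt α β s - gaussPrimitive (fun v ↦ -faddeevaInt (-v)) α β s =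
      -I * (√π / β ^ 2 * ((α - 1 / (2 * β)) * rexp (2 * α * β) -
        (α + 1 / (2 * β)) * rexp (-(2 * α * β))) : ℝ) := by
  have h1 := faddeevaInt_add_neg (β * s - α / s)
  have h2 := faddeevaInt_add_neg (β * s + α / s)
  have e1 : cexp (α ^ 2 / s ^ 2 + β ^ 2 * s ^ 2) * cexp (-(β * s - α / s) ^ 2) =
      rexp (2 * α * β) := by
    rw [← Complex.exp_add, Complex.ofReal_exp]
    congr 1
    push_cast
    field_simp
    ring
  have e2 : cexp (α ^ 2 / s ^ 2 + β ^ 2 * s ^ 2) * cexp (-(β * s + α / s) ^ 2) =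
      rexp (-(2 * α * β)) := by
    rw [← Complex.exp_add, Complex.ofReal_exp]
    congr 1
    push_cast
    field_simp
    ring
  simp only [gaussPrimitive]
  push_cast at e1 e2 ⊢
  rw [← e1, ← e2]
  linear_combination (cexp (α ^ 2 / s ^ 2 + β ^ 2 * s ^ 2) / β ^ 2) *
    (-I * (α - 1 / (2 * β)) * h1 + I * (α + 1 / (2 * β)) * h2)

theorem norm_integral_sqrt_mul_exp_sub_le {α β y X : ℝ} (hα : 0 < α) (hβ : 0 < β) (hy : 0 < y)
    (hX : 0 < X) (h : α ≤ β * X) :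
    ‖(∫ x : ℝ in -X..X, Complex.sqrt (y - I * x) *
        cexp (α ^ 2 / (y - I * x) + β ^ 2 * (y - I * x))) -
      (√π / β ^ 2 * ((α - 1 / (2 * β)) * rexp (2 * α * β) -
        (α + 1 / (2 * β)) * rexp (-(2 * α * β))) : ℝ)‖ ≤
      2 * (rexp (α ^ 2 * y / X ^ 2 + β ^ 2 * y) / β ^ 2 * (√(y + X) + 2 * α + 1 / β)) := by
  have hsl (x : ℝ) : (y - I * x : ℂ) ∈ slitPlane := by left; simpa using hy
  have hz (x : ℝ) : (y - I * x : ℂ) ≠ 0 := slitPlane_ne_zero (hsl x)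
  have hsq (z : ℂ) : Complex.sqrt z ^ 2 = z := by
    rw [Complex.sqrt, ← Complex.cpow_nat_mul]; simp
  have hs0 (x : ℝ) : Complex.sqrt (y - I * x) ≠ 0 := by
    intro h0
    have := hsq (y - I * x)
    rw [h0] at this
    exact hz x (by rw [← this]; simp)
  have hβ0 : (β : ℂ) ≠ 0 := mod_cast hβ.ne'
  have hderiv (x : ℝ) : HasDerivAt
      (fun x : ℝ ↦ I * gaussPrimitive faddeevaInt α β (Complex.sqrt (y - I * x)))
      (Complex.sqrt (y - I * x) * cexp (α ^ 2 / (y - I * x) + β ^ 2 * (y - I * x))) x := by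
    have h1 : HasDerivAt (fun x : ℂ ↦ (y - I * x : ℂ)) (-(I * 1)) x :=
      ((hasDerivAt_id _).const_mul I).const_sub _
    have h2 := (Complex.hasDerivAt_sqrt (hsl x)).comp (x : ℂ) h1
    have h3 := ((hasDerivAt_gaussPrimitive hasDerivAt_faddeevaInt α hβ0 (hs0 x)).comp (x : ℂ)
      h2).comp_ofReal.const_mul I
    convert! h3 using 1
    have h4 : (y - I * x : ℂ) ^ (-1 / 2 : ℂ) = (Complex.sqrt (y - I * x))⁻¹ := by
      rw [Complex.sqrt, ← Complex.cpow_neg]; norm_num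
    simp only [hsq, h4]
    have := hs0 x
    field_simp
    rw [I_sq, hsq]
    ring
  have hcont : Continuous fun x : ℝ ↦ Complex.sqrt (y - I * x) *
      cexp (α ^ 2 / (y - I * x) + β ^ 2 * (y - I * x)) := by
    refine Continuous.mul ?_ ?_
    · refine continuous_iff_continuousAt.mpr fun x ↦ ?_
      exact ContinuousAt.comp (f := fun x : ℝ ↦ (y - I * x : ℂ)) (g := Complex.sqrt)
        (Complex.hasDerivAt_sqrt (hsl x)).continuousAt (by fun_prop)
    · have : Continuous fun x : ℝ ↦ (α : ℂ) ^ 2 / (y - I * x) :=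
        Continuous.div (by fun_prop) (by fun_prop) hz
      fun_prop
  rw [intervalIntegral.integral_eq_sub_of_hasDerivAt (fun x _ ↦ hderiv x)
    (hcont.intervalIntegrable _ _)]
  set s₁ := Complex.sqrt (y - I * X) with hs₁
  set s₂ := Complex.sqrt (y - I * (-X : ℝ)) with hs₂
  have key := gaussPrimitive_faddeevaInt_sub (α := α) (β := β) (hs0 X)
  rw [← hs₁] at key
  set K : ℝ := √π / β ^ 2 * ((α - 1 / (2 * β)) * rexp (2 * α * β) -
        (α + 1 / (2 * β)) * rexp (-(2 * α * β))) with hK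
  have hfin : I * gaussPrimitive faddeevaInt α β s₁ - I * gaussPrimitive faddeevaInt α β s₂ - K =
      I * (gaussPrimitive (fun v ↦ -faddeevaInt (-v)) α β s₁ -
        gaussPrimitive faddeevaInt α β s₂) := by
    linear_combination I * key - K * I_sq
  rw [hfin, norm_mul, norm_I, one_mul]
  have hnz (x : ℝ) (hx : x ^ 2 = X ^ 2) : X ^ 2 ≤ ‖(y - I * x : ℂ)‖ ^ 2 := by
    rw [← Complex.normSq_eq_norm_sq, Complex.normSq_apply]
    simp
    nlinarith
  have hre (x : ℝ) (hx : x ^ 2 = X ^ 2) :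
      (α ^ 2 / (y - I * x) + β ^ 2 * (y - I * x) : ℂ).re ≤ α ^ 2 * y / X ^ 2 + β ^ 2 * y := by
    rw [← Complex.ofReal_pow, ← Complex.ofReal_pow, Complex.add_re, Complex.re_ofReal_mul,
      div_eq_mul_inv, Complex.re_ofReal_mul, Complex.inv_re, ← mul_div_assoc,
      Complex.normSq_eq_norm_sq]
    have : (y - I * x : ℂ).re = y := by simp
    rw [this]
    gcongr ?_ + _
    exact div_le_div_of_nonneg_left (by positivity) (by positivity) (hnz x hx)
  have hnn (x : ℝ) (hx : x ^ 2 = X ^ 2) : ‖(y - I * x : ℂ)‖ ≤ y + X := by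
    refine (norm_sub_le _ _).trans_eq ?_
    have : |x| = X := by rw [← abs_of_pos hX]; exact (sq_eq_sq_iff_abs_eq_abs _ _).mp hx
    simp [abs_of_pos hy, this]
  have hbound (V : ℂ → ℂ) (x : ℝ) (hx : x ^ 2 = X ^ 2)
      (h1 : ‖V (β * Complex.sqrt (y - I * x) - α / Complex.sqrt (y - I * x))‖ ≤ 1)
      (h2 : ‖V (β * Complex.sqrt (y - I * x) + α / Complex.sqrt (y - I * x))‖ ≤ 1) :
      ‖gaussPrimitive V α β (Complex.sqrt (y - I * x))‖ ≤
        rexp (α ^ 2 * y / X ^ 2 + β ^ 2 * y) / β ^ 2 * (√(y + X) + 2 * α + 1 / β) := by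
    refine (norm_gaussPrimitive_le hα hβ h1 h2).trans ?_
    rw [norm_sqrt_eq, hsq]
    gcongr
    · exact hre x hx
    · exact hnn x hx
  have him (x : ℝ) (hx : x ^ 2 = X ^ 2) :
      0 ≤ β - α / ‖Complex.sqrt (y - I * x)‖ ^ 2 ∧
      0 ≤ β - (-α : ℝ) / ‖Complex.sqrt (y - I * x)‖ ^ 2 := by
    rw [norm_sqrt_eq, Real.sq_sqrt (norm_nonneg _)]
    have h1 : X ≤ ‖(y - I * x : ℂ)‖ := (sq_le_sq₀ hX.le (norm_nonneg _)).mp (hnz x hx)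
    constructor
    · rw [sub_nonneg, div_le_iff₀ (by linarith)]
      exact h.trans (by gcongr)
    · rw [neg_div, sub_neg_eq_add]; positivity
  have hminus (s : ℂ) : β * s - α / s = β * s + (-α : ℝ) / s := by push_cast; ring
  have hs1im : s₁.im ≤ 0 := by
    rw [hs₁, Complex.sqrt, cpow_inv_two_im_eq_neg_sqrt (by simpa using hX)]
    exact neg_nonpos.mpr (Real.sqrt_nonneg _)
  have hs2im : 0 ≤ s₂.im := by
    rw [hs₂, Complex.sqrt, cpow_inv_two_im_eq_sqrt (by simpa using hX.le)]
    exact Real.sqrt_nonneg _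
  refine (norm_sub_le _ _).trans ?_
  rw [two_mul]
  refine add_le_add (hbound _ X rfl ?_ ?_) (hbound _ (-X) (by ring) ?_ ?_)
  · rw [norm_neg, hminus]
    refine norm_faddeevaInt_le ?_
    rw [Complex.neg_im, im_ofReal_mul_add_div, neg_nonneg]
    exact mul_nonpos_of_nonpos_of_nonneg hs1im (him X rfl).2
  · rw [norm_neg]
    refine norm_faddeevaInt_le ?_
    rw [Complex.neg_im, im_ofReal_mul_add_div, neg_nonneg]
    exact mul_nonpos_of_nonpos_of_nonneg hs1im (him X rfl).1
  · rw [hminus]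
    refine norm_faddeevaInt_le ?_
    rw [im_ofReal_mul_add_div]
    exact mul_nonneg hs2im (him (-X) (by ring)).2
  · refine norm_faddeevaInt_le ?_
    rw [im_ofReal_mul_add_div]
    exact mul_nonneg hs2im (him (-X) (by ring)).1

theorem norm_sq_two_mul_sub_one (x y : ℝ) :
    ‖2 * (x + y * I : ℂ) - 1‖ ^ 2 = 4 * ((x - 1 / 2) ^ 2 + y ^ 2) := by
  rw [← Complex.normSq_eq_norm_sq, Complex.normSq_apply]
  simp
  ring

theorem inv_norm_eta_le_of_le_abs_sub_half {x y : ℝ} (hy : 0 < y) (hy' : y ≤ 1 / 50)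
    (h1 : 0.75 * y ≤ |x - 1 / 2|) (h2 : |x - 1 / 2| ≤ 1 / 6) :
    ‖ModularForm.eta (x + y * I)‖⁻¹ ≤ 0.65 * rexp (π * (0.16 / y) / 12) := by
  have him : (x + y * I : ℂ).im = y := by simp
  have hsq := norm_sq_two_mul_sub_one x y
  have h3 : (0.75 * y) ^ 2 ≤ (x - 1 / 2) ^ 2 := by rw [← sq_abs (x - 1 / 2)]; gcongr
  have h4 : (x - 1 / 2) ^ 2 ≤ (1 / 6) ^ 2 := by rw [← sq_abs (x - 1 / 2)]; gcongr
  have h5 : ‖2 * (x + y * I : ℂ) - 1‖ ^ 2 ≤ 0.16 := by rw [hsq]; nlinarith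
  have h := inv_norm_eta_le_of_two_mul_sub_one (τ := x + y * I) (T := 0.16 / y)
    (by rwa [him])
    (by
      rw [him, div_mul_eq_mul_div, le_div_iff₀ hy, hsq]
      nlinarith)
    (by rw [him, div_mul_cancel₀ _ hy.ne']; exact h5)
  refine h.trans ?_
  have h6 : ‖2 * (x + y * I : ℂ) - 1‖ ≤ 0.4 := by
    refine (sq_le_sq₀ (norm_nonneg _) (by norm_num)).mp (h5.trans (by norm_num))
  have h7 : √‖2 * (x + y * I : ℂ) - 1‖ ≤ 0.64 := by
    rw [Real.sqrt_le_left (by norm_num)]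
    exact h6.trans (by norm_num)
  nlinarith [Real.exp_pos (π * (0.16 / y) / 12)]

theorem inv_norm_eta_le_of_abs_sub_half_le {x y : ℝ} (hy : 0 < y) (hy' : y ≤ 1 / 50)
    (h : |x - 1 / 2| ≤ 0.75 * y) :
    ‖ModularForm.eta (x + y * I)‖⁻¹ ≤ √(2.5 * y) * (1.01 * rexp (π * (0.25 / y) / 12)) := by
  have him : (x + y * I : ℂ).im = y := by simp
  have hsq := norm_sq_two_mul_sub_one x y
  have h4 : (x - 1 / 2) ^ 2 ≤ (0.75 * y) ^ 2 := by rw [← sq_abs (x - 1 / 2)]; gcongr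
  have h5 : ‖2 * (x + y * I : ℂ) - 1‖ ^ 2 ≤ (2.5 * y) ^ 2 := by rw [hsq]; nlinarith
  have h := inv_norm_eta_le_of_two_mul_sub_one (τ := x + y * I) (T := 0.25 / y)
    (by rwa [him])
    (by
      rw [him, div_mul_eq_mul_div, le_div_iff₀ hy, hsq]
      nlinarith [sq_nonneg (x - 1 / 2)])
    (by rw [him, div_mul_cancel₀ _ hy.ne']; nlinarith)
  refine h.trans ?_
  gcongr
  exact (sq_le_sq₀ (norm_nonneg _) (by positivity)).mp h5

theorem norm_inv_eta_sub_le_of_abs_le {x y : ℝ} (hy : 0 < y) (hy' : y ≤ 1 / 50)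
    (hx : |x| ≤ 1 / 3) :
    ‖(ModularForm.eta (x + y * I))⁻¹ -
      Complex.sqrt (y - I * x) * cexp ((π / 12 : ℝ) / (y - I * x))‖ ≤
      1.3 * rexp (π * (0.16 / y) / 12) := by
  have him : (x + y * I : ℂ).im = y := by simp
  have h1 : x ^ 2 ≤ (1 / 3) ^ 2 := by rw [← sq_abs x]; gcongr
  have h2 : ‖(x + y * I : ℂ)‖ ^ 2 ≤ 0.16 := by
    rw [← Complex.normSq_eq_norm_sq, Complex.normSq_add_mul_I]
    nlinarith
  have hz : -I * (x + y * I : ℂ) = y - I * x := by linear_combination (-y) * I_sq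
  have hτ0 : (x + y * I : ℂ) ≠ 0 := by
    intro h0
    rw [h0] at him
    simp at him
    linarith
  have hz0 : (y - I * x : ℂ) ≠ 0 := by rw [← hz]; simp [hτ0]
  have hexp : 2 * π * I / (24 * (x + y * I)) = (π / 12 : ℝ) / (y - I * x : ℂ) := by
    rw [← hz, div_eq_div_iff (by simp [hτ0]) (by simp [hτ0])]
    push_cast
    linear_combination -2 * π * (x + y * I) * I_sq
  have h := norm_inv_eta_sub_le (τ := x + y * I) (T := 0.16 / y) (by rwa [him])
    (by rw [le_div_iff₀ hy]; linarith) (by rw [him, div_mul_cancel₀ _ hy.ne']; exact h2)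
  rw [hz, hexp] at h
  refine h.trans ?_
  have h6 : ‖(x + y * I : ℂ)‖ ≤ 0.4 :=
    (sq_le_sq₀ (norm_nonneg _) (by norm_num)).mp (h2.trans (by norm_num))
  have h7 : √‖(x + y * I : ℂ)‖ ≤ 0.64 := by
    rw [Real.sqrt_le_left (by norm_num)]
    exact h6.trans (by norm_num)
  nlinarith [Real.exp_pos (π * (0.16 / y) / 12)]

theorem norm_partitionFn_sub_integral_le (n : ℕ) {y : ℝ} (hy : 0 < y) (hy' : y ≤ 1 / 50) :
    ‖(partitionFn n : ℂ) - ∫ x : ℝ in -(1 / 3)..(1 / 3), Complex.sqrt (y - I * x) *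
        cexp ((π / 12 : ℝ) / (y - I * x) + (2 * π * (n - 1 / 24) : ℝ) * (y - I * x))‖ ≤
      rexp (2 * π * (n - 1 / 24) * y) * (1.1 * rexp (π * (0.16 / y) / 12) +
        1.515 * y * (√(2.5 * y) * rexp (π * (0.25 / y) / 12))) := by
  set B : ℝ := rexp (2 * π * (n - 1 / 24) * y) with hB
  have hBpos : 0 < B := Real.exp_pos _
  set f : ℝ → ℂ := fun x ↦ (ModularForm.eta (x + y * I))⁻¹ *
    cexp (-2 * π * I * (n - 1 / 24) * (x + y * I)) with hf
  set g : ℝ → ℂ := fun x ↦ Complex.sqrt (y - I * x) *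
    cexp ((π / 12 : ℝ) / (y - I * x) + (2 * π * (n - 1 / 24) : ℝ) * (y - I * x)) with hg
  have hexp (x : ℝ) : ‖cexp (-2 * π * I * (n - 1 / 24) * (x + y * I))‖ = B := by
    have : -2 * π * I * (n - 1 / 24) * (x + y * I) =
        ((2 * π * (n - 1 / 24) * y : ℝ) : ℂ) + ((-2 * π * (n - 1 / 24) * x : ℝ) : ℂ) * I := by
      push_cast
      linear_combination (-2 * π * (n - 1 / 24) * y : ℂ) * I_sq
    rw [Complex.norm_exp, this, Complex.add_re, Complex.ofReal_re, Complex.re_ofReal_mul]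
    simp [hB]
  have hfn (x : ℝ) : ‖f x‖ = ‖ModularForm.eta (x + y * I)‖⁻¹ * B := by
    rw [hf, norm_mul, norm_inv, hexp]
  have hmem (x : ℝ) : (x + y * I : ℂ) ∈ UpperHalfPlane.upperHalfPlaneSet := by
    show 0 < (x + y * I : ℂ).im
    simpa using hy
  have hfc : Continuous f := by
    refine Continuous.mul (Continuous.inv₀ (continuous_iff_continuousAt.mpr fun x ↦ ?_)
      fun x ↦ ModularForm.eta_ne_zero (hmem x)) (by fun_prop)
    exact ContinuousAt.comp (f := fun x : ℝ ↦ (x + y * I : ℂ)) (g := ModularForm.eta)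
      (ModularForm.differentiableAt_eta_of_mem_upperHalfPlaneSet (hmem x)).continuousAt
      (by fun_prop)
  have hz (x : ℝ) : (y - I * x : ℂ) ∈ slitPlane := by left; simpa using hy
  have hgc : Continuous g := by
    refine Continuous.mul (continuous_iff_continuousAt.mpr fun x ↦ ?_) ?_
    · exact ContinuousAt.comp (f := fun x : ℝ ↦ (y - I * x : ℂ)) (g := Complex.sqrt)
        (Complex.hasDerivAt_sqrt (hz x)).continuousAt (by fun_prop)
    · have : Continuous fun x : ℝ ↦ ((π / 12 : ℝ) : ℂ) / (y - I * x) :=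
        Continuous.div (by fun_prop) (by fun_prop) fun x ↦ slitPlane_ne_zero (hz x)
      fun_prop
  have hfi (a b : ℝ) : IntervalIntegrable f volume a b := hfc.intervalIntegrable a b
  have hsub (x : ℝ) : f x - g x = ((ModularForm.eta (x + y * I))⁻¹ -
      Complex.sqrt (y - I * x) * cexp ((π / 12 : ℝ) / (y - I * x))) *
        cexp (-2 * π * I * (n - 1 / 24) * (x + y * I)) := by
    have : ((2 * π * (n - 1 / 24) : ℝ) : ℂ) * (y - I * x) =
        -2 * π * I * (n - 1 / 24) * (x + y * I) := by
      push_cast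
      linear_combination (2 * π * (n - 1 / 24) * y : ℂ) * I_sq
    simp only [hf, hg]
    rw [this, Complex.exp_add]
    ring
  have hshift (x : ℝ) : ‖ModularForm.eta (x + y * I)‖ =
      ‖ModularForm.eta ((x + 1 : ℝ) + y * I)‖ := by
    rw [← norm_eta_add_one]
    congr 2
    push_cast
    ring
  set E₁ := rexp (π * (0.16 / y) / 12)
  set E₂ := rexp (π * (0.25 / y) / 12)
  have hmid : ‖∫ x in (-(1 / 3) : ℝ)..(1 / 3), (f x - g x)‖ ≤
      1.3 * E₁ * B * |1 / 3 - (-(1 / 3) : ℝ)| := by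
    refine intervalIntegral.norm_integral_le_of_norm_le_const fun x hx ↦ ?_
    rw [uIoc_of_le (by norm_num), mem_Ioc] at hx
    rw [hsub, norm_mul, hexp]
    gcongr
    exact norm_inv_eta_sub_le_of_abs_le hy hy' (abs_le.mpr ⟨by linarith, by linarith⟩)
  have hr1 : ‖∫ x in (1 / 3 : ℝ)..(1 / 2 - 0.75 * y), f x‖ ≤
      0.65 * E₁ * B * |1 / 2 - 0.75 * y - 1 / 3| := by
    refine intervalIntegral.norm_integral_le_of_norm_le_const fun x hx ↦ ?_
    rw [uIoc_of_le (by linarith), mem_Ioc] at hx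
    rw [hfn]
    gcongr
    have : |x - 1 / 2| = 1 / 2 - x := by rw [abs_of_nonpos (by linarith)]; ring
    exact inv_norm_eta_le_of_le_abs_sub_half hy hy' (by linarith) (by linarith)
  have hl1 : ‖∫ x in (-(1 / 2) + 0.75 * y : ℝ)..(-(1 / 3)), f x‖ ≤
      0.65 * E₁ * B * |-(1 / 3) - (-(1 / 2) + 0.75 * y)| := by
    refine intervalIntegral.norm_integral_le_of_norm_le_const fun x hx ↦ ?_
    rw [uIoc_of_le (by linarith), mem_Ioc] at hx
    rw [hfn, hshift]
    gcongr
    have : |x + 1 - 1 / 2| = x + 1 - 1 / 2 := abs_of_nonneg (by linarith)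
    exact inv_norm_eta_le_of_le_abs_sub_half hy hy' (by linarith) (by linarith)
  have hr2 : ‖∫ x in (1 / 2 - 0.75 * y : ℝ)..(1 / 2), f x‖ ≤
      √(2.5 * y) * (1.01 * E₂) * B * |1 / 2 - (1 / 2 - 0.75 * y)| := by
    refine intervalIntegral.norm_integral_le_of_norm_le_const fun x hx ↦ ?_
    rw [uIoc_of_le (by linarith), mem_Ioc] at hx
    rw [hfn]
    gcongr
    exact inv_norm_eta_le_of_abs_sub_half_le hy hy' (abs_le.mpr ⟨by linarith, by linarith⟩)
  have hl2 : ‖∫ x in (-(1 / 2) : ℝ)..(-(1 / 2) + 0.75 * y), f x‖ ≤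
      √(2.5 * y) * (1.01 * E₂) * B * |-(1 / 2) + 0.75 * y - -(1 / 2)| := by
    refine intervalIntegral.norm_integral_le_of_norm_le_const fun x hx ↦ ?_
    rw [uIoc_of_le (by linarith), mem_Ioc] at hx
    rw [hfn, hshift]
    gcongr
    exact inv_norm_eta_le_of_abs_sub_half_le hy hy' (abs_le.mpr ⟨by linarith, by linarith⟩)
  rw [abs_of_nonneg (by linarith)] at hmid hr1 hl1 hr2 hl2
  rw [partitionFn_eq_integral n hy]
  have e1 := intervalIntegral.integral_add_adjacent_intervals (hfi (-(1 / 2)) (-(1 / 2) + 0.75 * y))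
    (hfi (-(1 / 2) + 0.75 * y) (-(1 / 3)))
  have e2 := intervalIntegral.integral_add_adjacent_intervals (hfi (-(1 / 2)) (-(1 / 3)))
    (hfi (-(1 / 3)) (1 / 3))
  have e3 := intervalIntegral.integral_add_adjacent_intervals (hfi (-(1 / 2)) (1 / 3))
    (hfi (1 / 3) (1 / 2 - 0.75 * y))
  have e4 := intervalIntegral.integral_add_adjacent_intervals (hfi (-(1 / 2)) (1 / 2 - 0.75 * y))
    (hfi (1 / 2 - 0.75 * y) (1 / 2))
  rw [intervalIntegral.integral_sub (hfi _ _) (hgc.intervalIntegrable _ _)] at hmid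
  rw [← e4, ← e3, ← e2, ← e1]
  set J₁ := ∫ x in (-(1 / 2) : ℝ)..(-(1 / 2) + 0.75 * y), f x
  set J₂ := ∫ x in (-(1 / 2) + 0.75 * y : ℝ)..(-(1 / 3)), f x
  set J₃ := ∫ x in (-(1 / 3) : ℝ)..(1 / 3), f x
  set J₄ := ∫ x in (1 / 3 : ℝ)..(1 / 2 - 0.75 * y), f x
  set J₅ := ∫ x in (1 / 2 - 0.75 * y : ℝ)..(1 / 2), f x
  set J := ∫ x in (-(1 / 3) : ℝ)..(1 / 3), g x
  have htri : ‖J₁ + J₂ + J₃ + J₄ + J₅ - J‖ ≤ ‖J₁‖ + ‖J₂‖ + ‖J₃ - J‖ + ‖J₄‖ + ‖J₅‖ := by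
    rw [show J₁ + J₂ + J₃ + J₄ + J₅ - J = J₁ + J₂ + (J₃ - J) + J₄ + J₅ by ring]
    refine (norm_add_le _ _).trans (add_le_add_left ?_ _)
    refine (norm_add_le _ _).trans (add_le_add_left ?_ _)
    refine (norm_add_le _ _).trans (add_le_add_left ?_ _)
    exact norm_add_le _ _
  have hE : 0 < E₁ * B := mul_pos (Real.exp_pos _) hBpos
  have hyE := mul_pos hy hE
  refine htri.trans ?_
  linarith

theorem muP_sq (n : ℕ) (hn : 0 < n) : muP n ^ 2 = 2 * π ^ 2 * (n - 1 / 24) / 3 := by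
  have h : (1 : ℝ) ≤ n := mod_cast hn
  rw [muP, div_pow, mul_pow, Real.sq_sqrt (by linarith)]
  ring

theorem abs_partitionFn_sub_le (n : ℕ) (hn : 0 < n) (hμ : 118 ≤ muP n) :
    |(partitionFn n : ℝ) - √12 * π ^ 2 / (36 * muP n ^ 2) *
        ((1 - 1 / muP n) * rexp (muP n) - (1 + 1 / muP n) * rexp (-muP n))| ≤
      1.5 * rexp (0.41 * muP n) + 1.515 * (π / (12 * muP n)) *
        (√(2.5 * (π / (12 * muP n))) * rexp (0.5 * muP n)) := by
  have hsq := muP_sq n hn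
  set μ := muP n
  have hμ0 : 0 < μ := by linarith
  have hπ := pi_pos
  have hπ3 := Real.pi_gt_three
  have hπ' := Real.pi_lt_d2
  set y := π / (12 * μ) with hy
  have hy0 : 0 < y := by positivity
  have hy1 : y ≤ 1 / 50 := by
    rw [hy, div_le_iff₀ (by positivity)]
    linarith
  set N : ℝ := n - 1 / 24 with hN
  have hN' : 2 * π * N = 3 * μ ^ 2 / π := by rw [hsq]; field_simp
  have h1 := norm_partitionFn_sub_integral_le n hy0 hy1
  set α := √(π / 12) with hα
  set β := μ * √(3 / π) with hβ
  have hα0 : 0 < α := by positivity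
  have hβ0 : 0 < β := by positivity
  have hα2 : α ^ 2 = π / 12 := Real.sq_sqrt (by positivity)
  have hβ2 : β ^ 2 = 2 * π * N := by rw [hN', hβ, mul_pow, Real.sq_sqrt (by positivity)]; ring
  have hαβ : α * β = μ / 2 := by
    refine (sq_eq_sq₀ (by positivity) (by positivity)).mp ?_
    rw [mul_pow, hα2, hβ2, hN']
    field_simp
    norm_num
  have hα1 : α ≤ 0.6 := by
    rw [hα, Real.sqrt_le_left (by norm_num)]
    linarith
  have hβ1 : 60 ≤ β := by nlinarith
  have h2 := norm_integral_sqrt_mul_exp_sub_le hα0 hβ0 hy0 (X := 1 / 3) (by norm_num)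
    (by linarith)
  rw [← hN, ← hα2, ← hβ2] at h1
  set K : ℝ := √π / β ^ 2 * ((α - 1 / (2 * β)) * rexp (2 * α * β) -
        (α + 1 / (2 * β)) * rexp (-(2 * α * β))) with hK
  have hKeq : K = √12 * π ^ 2 / (36 * μ ^ 2) *
      ((1 - 1 / μ) * rexp μ - (1 + 1 / μ) * rexp (-μ)) := by
    have e1 : 1 / (2 * β) = α / μ := by
      rw [div_eq_div_iff (by positivity) hμ0.ne']
      linarith
    have e2 : √π * α = π * √12 / 12 := by
      have h12 : √12 * √12 = (12 : ℝ) := Real.mul_self_sqrt (by norm_num)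
      have hππ : √π * √π = π := Real.mul_self_sqrt hπ.le
      rw [hα, Real.sqrt_div hπ.le, ← mul_div_assoc, hππ, div_eq_div_iff (by positivity)
        (by norm_num), mul_assoc, h12]
    have e3 : K = √π * α / β ^ 2 * ((1 - 1 / μ) * rexp (2 * (α * β)) -
        (1 + 1 / μ) * rexp (-(2 * (α * β)))) := by
      rw [hK, e1, mul_assoc 2 α β]
      ring
    rw [e3, e2, hαβ, hβ2, hN', mul_div_cancel₀ μ two_ne_zero]
    field_simp
    ring
  rw [← hKeq]
  set J := ∫ x : ℝ in -(1 / 3)..(1 / 3), Complex.sqrt (y - I * x) *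
    cexp ((α ^ 2 : ℝ) / (y - I * x) + (β ^ 2 : ℝ) * (y - I * x)) with hJ
  have h3 : ‖J - (K : ℂ)‖ ≤
      2 * (rexp (α ^ 2 * y / (1 / 3) ^ 2 + β ^ 2 * y) / β ^ 2 * (√(y + 1 / 3) + 2 * α + 1 / β)) := by
    rw [hJ]
    push_cast at h2 ⊢
    exact h2
  have hβy : β ^ 2 * y = 0.25 * μ := by
    rw [hβ2, hN', hy]
    field_simp
    norm_num
  have hx1 : π * (0.16 / y) / 12 = 0.16 * μ := by rw [hy]; field_simp
  have hx2 : π * (0.25 / y) / 12 = 0.25 * μ := by rw [hy]; field_simp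
  rw [hβy, hx1, hx2, mul_add, mul_left_comm, ← Real.exp_add, mul_left_comm _ (1.515 * y),
    mul_left_comm _ (√(2.5 * y)), ← Real.exp_add] at h1
  rw [hβy] at h3
  have h4 : 2 * (rexp (α ^ 2 * y / (1 / 3) ^ 2 + 0.25 * μ) / β ^ 2 *
      (√(y + 1 / 3) + 2 * α + 1 / β)) ≤ 0.4 * rexp (0.41 * μ) := by
    have hs : √(y + 1 / 3) ≤ 1 := Real.sqrt_le_one.mpr (by linarith)
    have hb : 1 / β ≤ 1 := by rw [div_le_one hβ0]; linarith
    have he : rexp (α ^ 2 * y / (1 / 3) ^ 2 + 0.25 * μ) ≤ rexp (0.41 * μ) := by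
      have hπy : π * y ≤ 3.15 * (1 / 50) := by gcongr
      have h9 : π / 12 * y / (1 / 3) ^ 2 = 0.75 * (π * y) := by ring
      rw [Real.exp_le_exp, hα2, h9]
      linarith
    have hβ3 : (60 : ℝ) ^ 2 ≤ β ^ 2 := by gcongr
    calc _ ≤ 2 * (rexp (0.41 * μ) / 60 ^ 2 * (1 + 2 * 0.6 + 1)) := by gcongr
      _ ≤ _ := by linarith [Real.exp_pos (0.41 * μ)]
  rw [show 0.25 * μ + 0.16 * μ = 0.41 * μ by ring,
    show 0.25 * μ + 0.25 * μ = 0.5 * μ by ring] at h1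
  have h5 : |(partitionFn n : ℝ) - K| = ‖(partitionFn n : ℂ) - K‖ := by
    rw [← Complex.ofReal_natCast, ← Complex.ofReal_sub, Complex.norm_real, Real.norm_eq_abs]
  rw [h5]
  refine (norm_sub_le_norm_sub_add_norm_sub _ J _).trans ?_
  linarith

theorem log_le_add_mul {x : ℝ} (hx : 118.1 ≤ x) : Real.log x ≤ 3.775 + 10 / 1181 * x := by
  have h1 : Real.log x = Real.log 128 + Real.log (118.1 / 128) + Real.log (x / 118.1) := by
    rw [← Real.log_mul (by norm_num) (by norm_num), ← Real.log_mul (by norm_num) (by positivity)]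
    congr 1
    ring
  have h2 : Real.log 128 = 7 * Real.log 2 := by
    rw [show (128 : ℝ) = 2 ^ 7 by norm_num, Real.log_pow]; norm_num
  have h3 := Real.log_two_lt_d9
  have h4 : Real.log (118.1 / 128) ≤ -0.0773 :=
    (Real.log_le_sub_one_of_pos (by norm_num)).trans (by norm_num)
  have h5 : Real.log (x / 118.1) ≤ 10 / 1181 * x - 1 :=
    (Real.log_le_sub_one_of_pos (by positivity)).trans_eq (by ring)
  rw [h1, h2]
  linarith

theorem pow_mul_error_lt {μ : ℝ} (hμ : 118.1 ≤ μ) :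
    μ ^ 14 * (1.6 * rexp (0.41 * μ) + 1.515 * (π / (12 * μ)) *
      (√(2.5 * (π / (12 * μ))) * rexp (0.5 * μ))) < 0.949 * rexp μ := by
  have hμ0 : 0 < μ := by linarith
  have hlog := log_le_add_mul hμ
  have hπ := Real.pi_lt_d6
  have h1 : μ ^ 14 * rexp (0.41 * μ) ≤ 1 / 11 * rexp μ := by
    have e1 : μ ^ 14 * rexp (0.41 * μ) = rexp (14 * Real.log μ + 0.41 * μ) := by
      rw [Real.exp_add, show 14 * Real.log μ = (14 : ℕ) * Real.log μ by norm_num, Real.exp_nat_mul,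
        Real.exp_log hμ0]
    have e2 : (11 : ℝ) ≤ rexp 2.5 := by
      have h1 := Real.exp_one_gt_d9
      have h2 := Real.add_one_le_exp (0.5 : ℝ)
      have h3 : rexp 2.5 = rexp 1 * rexp 1 * rexp 0.5 := by
        rw [← Real.exp_add, ← Real.exp_add]; norm_num
      have h4 : (2.718 : ℝ) * 2.718 ≤ rexp 1 * rexp 1 := by gcongr <;> linarith
      rw [h3]
      nlinarith
    have e3 : rexp (14 * Real.log μ + 0.41 * μ) ≤ rexp (-2.5) * rexp μ := by
      rw [← Real.exp_add, Real.exp_le_exp]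
      linarith
    rw [e1]
    refine e3.trans ?_
    gcongr
    rw [Real.exp_neg, one_div]
    exact inv_anti₀ (by norm_num) e2
  have h2 : μ ^ 13 * rexp (0.5 * μ) ≤ √μ * (1.9 * rexp μ) := by
    have e1 : μ ^ 13 * rexp (0.5 * μ) = √μ * rexp (12.5 * Real.log μ + 0.5 * μ) := by
      have e0 : √μ = rexp (0.5 * Real.log μ) := by
        rw [← Real.exp_log (Real.sqrt_pos.mpr hμ0), Real.log_sqrt hμ0.le]
        congr 1
        ring
      rw [e0, ← Real.exp_add, ← add_assoc, Real.exp_add, ← add_mul,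
        show (0.5 + 12.5) * Real.log μ = (13 : ℕ) * Real.log μ by norm_num, Real.exp_nat_mul,
        Real.exp_log hμ0]
    have e2 : rexp 0.64 ≤ 1.9 := by
      refine le_of_pow_le_pow_left₀ (n := 25) (by norm_num) (by norm_num) ?_
      have h1 : rexp 0.64 ^ 25 = rexp 1 ^ 16 := by
        rw [← Real.exp_nat_mul, ← Real.exp_nat_mul]; norm_num
      have h2 := Real.exp_one_lt_d9
      rw [h1]
      calc rexp 1 ^ 16 ≤ 2.7182818286 ^ 16 := by gcongr
        _ ≤ _ := by norm_num
    rw [e1]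
    refine mul_le_mul_of_nonneg_left ?_ (Real.sqrt_nonneg μ)
    calc rexp (12.5 * Real.log μ + 0.5 * μ) ≤ rexp (0.64 + μ) := by
          rw [Real.exp_le_exp]
          linarith
      _ ≤ _ := by rw [Real.exp_add]; gcongr
  have h3 : √(2.5 * (π / (12 * μ))) ≤ 0.8091 / √μ := by
    rw [show 2.5 * (π / (12 * μ)) = (2.5 * π / 12) / μ by field_simp, Real.sqrt_div' _ hμ0.le]
    gcongr
    rw [Real.sqrt_le_left (by norm_num)]
    linarith
  have hs : 0 < √μ := Real.sqrt_pos.mpr hμ0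
  calc _ = 1.6 * (μ ^ 14 * rexp (0.41 * μ)) + 1.515 * (π / 12) *
        (√(2.5 * (π / (12 * μ))) * (μ ^ 13 * rexp (0.5 * μ))) := by
        field_simp
    _ ≤ 1.6 * (1 / 11 * rexp μ) + 1.515 * (3.141593 / 12) *
        (0.8091 / √μ * (√μ * (1.9 * rexp μ))) := by gcongr
    _ = (1.6 / 11 + 1.515 * (3.141593 / 12) * 0.8091 * 1.9) * rexp μ := by
        field_simp
    _ < _ := by
        gcongr
        norm_num

theorem le_muP {n : ℕ} (hn : 2120 ≤ n) : 118.1 ≤ muP n := by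
  have h1 : (2120 : ℝ) ≤ n := mod_cast hn
  have h2 : (225.56 : ℝ) ≤ √(24 * n - 1) := by
    refine Real.le_sqrt_of_sq_le ?_
    norm_num
    linarith
  have h3 := Real.pi_gt_d6
  rw [muP, le_div_iff₀ (by norm_num)]
  calc (118.1 : ℝ) * 6 ≤ 3.141592 * 225.56 := by norm_num
    _ ≤ _ := by gcongr

theorem partition_bounds_l (n : ℕ) (hn : 2120 ≤ n) :
    Real.sqrt 12 * Real.pi ^ 2 * Real.exp (muP n) / (36 * (muP n) ^ 14) *
        ((muP n) ^ 12 - (muP n) ^ 11 - 1) < (partitionFn n : ℝ) ∧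
    (partitionFn n : ℝ) <
      Real.sqrt 12 * Real.pi ^ 2 * Real.exp (muP n) / (36 * (muP n) ^ 14) *
        ((muP n) ^ 12 - (muP n) ^ 11 + 1) := by
  have hμ := le_muP hn
  have h1 := abs_partitionFn_sub_le n (by omega) (by linarith)
  have h2 := pow_mul_error_lt hμ
  set μ := muP n
  have hμ0 : 0 < μ := by linarith
  have h12 : (3.464 : ℝ) ≤ √12 := Real.le_sqrt_of_sq_le (by norm_num)
  have h12' : √12 ≤ 3.5 := by rw [Real.sqrt_le_left (by norm_num)]; norm_num
  have hπ := Real.pi_gt_d4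
  have hπ' := Real.pi_lt_d2
  set A := √12 * π ^ 2 / 36 with hA
  have hA1 : 0.949 ≤ A := by
    rw [hA, le_div_iff₀ (by norm_num)]
    calc (0.949 : ℝ) * 36 ≤ 3.464 * 3.1415 ^ 2 := by norm_num
      _ ≤ _ := by gcongr
  have hA2 : A ≤ 1 := by
    rw [hA, div_le_one (by norm_num)]
    calc √12 * π ^ 2 ≤ 3.5 * 3.15 ^ 2 := by gcongr
      _ ≤ _ := by norm_num
  set Err := 1.515 * (π / (12 * μ)) * (√(2.5 * (π / (12 * μ))) * rexp (0.5 * μ))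
  have hsmall : A / μ ^ 2 * ((1 + 1 / μ) * rexp (-μ)) ≤ 0.1 * rexp (0.41 * μ) := by
    have e1 : A / μ ^ 2 ≤ 0.05 := by
      rw [div_le_iff₀ (by positivity)]
      nlinarith
    have e2 : 1 / μ ≤ 1 := by rw [div_le_one hμ0]; linarith
    have e3 : rexp (-μ) ≤ rexp (0.41 * μ) := by
      rw [Real.exp_le_exp]
      linarith
    calc _ ≤ 0.05 * ((1 + 1) * rexp (0.41 * μ)) := by gcongr
      _ = _ := by ring
  have hsmall0 : 0 ≤ A / μ ^ 2 * ((1 + 1 / μ) * rexp (-μ)) := by positivity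
  have h3 : 1.6 * rexp (0.41 * μ) + Err < A * rexp μ / μ ^ 14 := by
    rw [lt_div_iff₀ (by positivity), mul_comm]
    exact h2.trans_le (by gcongr)
  have hmain : √12 * π ^ 2 / (36 * μ ^ 2) * ((1 - 1 / μ) * rexp μ - (1 + 1 / μ) * rexp (-μ)) =
      A / μ ^ 2 * ((1 - 1 / μ) * rexp μ) - A / μ ^ 2 * ((1 + 1 / μ) * rexp (-μ)) := by
    rw [hA]
    field_simp
  rw [hmain, abs_le] at h1
  have hl : √12 * π ^ 2 * rexp μ / (36 * μ ^ 14) * (μ ^ 12 - μ ^ 11 - 1) =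
      A / μ ^ 2 * ((1 - 1 / μ) * rexp μ) - A * rexp μ / μ ^ 14 := by
    rw [hA]
    field_simp
  have hr : √12 * π ^ 2 * rexp μ / (36 * μ ^ 14) * (μ ^ 12 - μ ^ 11 + 1) =
      A / μ ^ 2 * ((1 - 1 / μ) * rexp μ) + A * rexp μ / μ ^ 14 := by
    rw [hA]
    field_simp
  rw [hl, hr]
  constructor <;> linarith [h1.1, h1.2]
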